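/- arXiv:0801.4181 — 2 statements merged into one kernel-verified Lean document; each statement's English description precedes it below -/
import Mathlib

section
/- For every integer k ≥ 2 and every prime p ≤ k, we have −2 < a_p(k) − k/(p−1) ≤ log_p k (as real numbers). -/
/-- `e p k = ν_p(k!)`, the exponent of the prime `p` in `k!`. -/
def epow (p k : ℕ) : ℕ := padicValNat p (Nat.factorial k)

/-- The falling-factorial product `n (n-1) ⋯ (n-k+1)` over `ℤ`. -/
def fallingProd (k : ℕ) (n : ℤ) : ℤ := ∏ j ∈ Finset.range k, (n - (j : ℤ))

/-- `D p k n`: the predicate that `p^(2 e_p(k))` divides `n (n-1) ⋯ (n-k+1)` in `ℤ`. -/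
def Dpred (p k : ℕ) (n : ℤ) : Prop := ((p : ℤ)) ^ (2 * epow p k) ∣ fallingProd k n

/-- `aexp p k`: the least `m ≥ 0` such that `D p k n` depends only on the residue class of
`n` modulo `p^m`. -/
noncomputable def aexp (p k : ℕ) : ℕ :=
  sInf {m : ℕ | ∀ n n' : ℤ, n ≡ n' [ZMOD ((p : ℤ) ^ m)] → (Dpred p k n ↔ Dpred p k n')}

lemma fallingProd_modEq {k : ℕ} {n n' N : ℤ} (h : n ≡ n' [ZMOD N]) :
    fallingProd k n ≡ fallingProd k n' [ZMOD N] := by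
  unfold fallingProd
  exact Int.ModEq.prod (fun j _ => h.sub_right _)

lemma fallingProd_nat (k n : ℕ) : fallingProd k (n : ℤ) = (n.descFactorial k : ℤ) := by
  unfold fallingProd
  induction k with
  | zero => simp
  | succ k ih =>
    rw [Finset.prod_range_succ, ih, Nat.descFactorial_succ]
    rcases le_or_gt k n with h | h
    · push_cast [Nat.cast_sub h]; ring
    · rw [Nat.descFactorial_of_lt h]; simp

lemma Dpred_nat (p k n : ℕ) (hp : p.Prime) (hkn : k ≤ n) :
    Dpred p k (n : ℤ) ↔ epow p k ≤ padicValNat p (n.choose k) := by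
  have := Fact.mk hp
  unfold Dpred
  rw [fallingProd_nat, Nat.descFactorial_eq_factorial_mul_choose]
  have hc : n.choose k ≠ 0 := (Nat.choose_pos hkn).ne'
  have hne : k.factorial * n.choose k ≠ 0 := mul_ne_zero (Nat.factorial_ne_zero k) hc
  rw [← Nat.cast_pow, Int.natCast_dvd_natCast, padicValNat_dvd_iff_le hne,
    padicValNat.mul (Nat.factorial_ne_zero k) hc]
  unfold epow
  omega

/-- If `p^(e+L)` divides one of the factors, `D` holds (naturals). -/
lemma Dpred_of_dvd_nat (p k n j : ℕ) (hp : p.Prime) (hkn : k ≤ n) (hj : j < k)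
    (h : p ^ (epow p k + Nat.log p k) ∣ n - j) : Dpred p k (n : ℤ) := by
  have := Fact.mk hp
  rw [Dpred_nat p k n hp hkn]
  set e := epow p k
  set L := Nat.log p k with hL
  rw [padicValNat_choose (b := max (Nat.log p n + 1) (e + L + 1)) hkn (by omega)]
  have hsub : Finset.Ioc L (e + L) ⊆ {i ∈ Finset.Ico 1 (max (Nat.log p n + 1) (e + L + 1)) |
      p ^ i ≤ k % p ^ i + (n - k) % p ^ i} := by
    intro i hi
    rw [Finset.mem_Ioc] at hi
    rw [Finset.mem_filter, Finset.mem_Ico]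
    refine ⟨by omega, ?_⟩
    have hki : k < p ^ i := Nat.lt_pow_of_log_lt hp.one_lt hi.1
    rw [Nat.mod_eq_of_lt hki]
    have hd : p ^ i ∣ n - j := (pow_dvd_pow p hi.2).trans h
    by_contra hlt
    push Not at hlt
    obtain ⟨q, hq⟩ := hd
    have h1 := Nat.mod_add_div (n - k) (p ^ i)
    set r := (n - k) % p ^ i
    set s := (n - k) / p ^ i
    clear_value r s
    have h2 : p ^ i * q = r + (k - j) + p ^ i * s := by omega
    have h3 : p ^ i * s < p ^ i * q := by omega
    have h4 : p ^ i * q < p ^ i * (s + 1) := by rw [mul_add]; omega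
    have h5 := Nat.lt_of_mul_lt_mul_left h3
    have h6 := Nat.lt_of_mul_lt_mul_left h4
    omega
  have := Finset.card_le_card hsub
  rw [Nat.card_Ioc] at this
  omega

lemma Dpred_of_dvd (p k j : ℕ) (n : ℤ) (hp : p.Prime) (hj : j < k)
    (h : (p : ℤ) ^ (epow p k + Nat.log p k) ∣ n - j) : Dpred p k n := by
  set m := epow p k + Nat.log p k with hm
  set N := n + (p : ℤ) ^ (2 * epow p k + m) * (|n| + k) with hN
  have hP : (1 : ℤ) ≤ (p : ℤ) ^ (2 * epow p k + m) := by
    exact_mod_cast Nat.one_le_pow _ _ hp.pos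
  have hNk : (k : ℤ) ≤ N := by
    have h1 : |n| + k ≤ (p : ℤ) ^ (2 * epow p k + m) * (|n| + k) :=
      le_mul_of_one_le_left (by positivity) hP
    have := neg_abs_le n
    linarith
  obtain ⟨M, hM⟩ := Int.eq_ofNat_of_zero_le (show 0 ≤ N by omega)
  have hMk : k ≤ M := by omega
  have hdN : (p : ℤ) ^ m ∣ N - j := by
    have : N - j = (n - j) + (p : ℤ) ^ (2 * epow p k + m) * (|n| + k) := by rw [hN]; ring
    rw [this]
    exact dvd_add h ((pow_dvd_pow _ (by omega)).mul_right _)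
  have hdM : p ^ m ∣ M - j := by
    rw [hM, ← Nat.cast_sub (by omega)] at hdN
    exact_mod_cast hdN
  have hD := Dpred_of_dvd_nat p k M j hp hMk hj hdM
  unfold Dpred at hD ⊢
  rw [← hM] at hD
  have hmod : N ≡ n [ZMOD (p : ℤ) ^ (2 * epow p k)] := by
    apply Int.ModEq.symm
    rw [Int.modEq_iff_dvd, hN, add_sub_cancel_left]
    exact (pow_dvd_pow _ (by omega)).mul_right _
  exact (fallingProd_modEq hmod).dvd_iff.1 hD

lemma mem_upper (p k : ℕ) (hp : p.Prime) (n n' : ℤ)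
    (h : n ≡ n' [ZMOD ((p : ℤ) ^ (epow p k + Nat.log p k))]) : Dpred p k n ↔ Dpred p k n' := by
  set m := epow p k + Nat.log p k with hm
  rw [Int.modEq_iff_dvd] at h
  by_cases hex : ∃ j < k, (p : ℤ) ^ m ∣ n - j
  · obtain ⟨j, hj, hd⟩ := hex
    have hd' : (p : ℤ) ^ m ∣ n' - j := by
      have := dvd_add h hd
      rwa [show n' - n + (n - j) = n' - j by ring] at this
    exact iff_of_true (Dpred_of_dvd p k j n hp hj hd) (Dpred_of_dvd p k j n' hp hj hd')
  · push Not at hex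
    have hpz : Prime (p : ℤ) := Nat.prime_iff_prime_int.1 hp
    unfold Dpred fallingProd
    rw [pow_dvd_iff_le_emultiplicity, pow_dvd_iff_le_emultiplicity,
      Finset.emultiplicity_prod hpz, Finset.emultiplicity_prod hpz]
    have : ∀ j ∈ Finset.range k,
        emultiplicity (p : ℤ) (n - j) = emultiplicity (p : ℤ) (n' - j) := by
      intro j hj
      have h1 := hex j (Finset.mem_range.1 hj)
      rw [pow_dvd_iff_le_emultiplicity] at h1 h
      rw [show n' - j = (n' - n) + (n - j) by ring]
      exact (emultiplicity_add_of_gt (lt_of_lt_of_le (not_le.1 h1) h)).symm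
    rw [Finset.sum_congr rfl this]

lemma not_Dpred (p k m : ℕ) (hp : p.Prime) (hk : k ≠ 0) (hLm : Nat.log p k ≤ m)
    (hm : m < epow p k + Nat.log p k) :
    ¬ Dpred p k ((k % p ^ Nat.log p k + (p - 1) * p ^ m : ℕ) : ℤ) := by
  have := Fact.mk hp
  set L := Nat.log p k with hL
  have hpL : 0 < p ^ L := Nat.pow_pos hp.pos
  have hk1 : k < p ^ (L + 1) := Nat.lt_pow_succ_log_self hp.one_lt k
  have hdm := Nat.mod_add_div k (p ^ L)
  have hmod := Nat.mod_lt k hpL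
  set c := k / p ^ L
  set r := k % p ^ L
  clear_value r c
  have hc : c ≤ p - 1 := by
    have : p ^ L * c < p ^ L * p := by rw [← pow_succ]; omega
    have := Nat.lt_of_mul_lt_mul_left this
    omega
  obtain ⟨d, rfl⟩ := Nat.exists_eq_add_of_le hLm
  have hpd : 1 ≤ p ^ d := Nat.one_le_pow _ _ hp.pos
  have hsub : c ≤ (p - 1) * p ^ d := hc.trans (Nat.le_mul_of_pos_right _ hpd)
  have hn : r + (p - 1) * p ^ (L + d) = k + p ^ L * ((p - 1) * p ^ d - c) := by
    have h1 : p ^ L * c ≤ p ^ L * ((p - 1) * p ^ d) := Nat.mul_le_mul_left _ hsub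
    have h2 : p ^ L * ((p - 1) * p ^ d) = (p - 1) * p ^ (L + d) := by rw [pow_add]; ring
    rw [Nat.mul_sub]
    omega
  have hlt : r + (p - 1) * p ^ (L + d) < p ^ (L + d + 1) := by
    have h1 : p ^ L ≤ p ^ (L + d) := Nat.pow_le_pow_right hp.pos (by omega)
    have h2 : (p - 1) * p ^ (L + d) + p ^ (L + d) = p ^ (L + d + 1) := by
      rw [← Nat.succ_mul, Nat.succ_eq_add_one, Nat.sub_add_cancel hp.one_le, pow_succ, mul_comm]
    omega
  rw [Dpred_nat p k _ hp (by omega), not_le]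
  rw [padicValNat_choose (b := L + d + 1) (by omega) (Nat.log_lt_of_lt_pow' (by omega) hlt)]
  have hss : {i ∈ Finset.Ico 1 (L + d + 1) | p ^ i ≤ k % p ^ i +
      (r + (p - 1) * p ^ (L + d) - k) % p ^ i} ⊆ Finset.Ioc L (L + d) := by
    intro i hi
    rw [Finset.mem_filter, Finset.mem_Ico] at hi
    rw [Finset.mem_Ioc]
    refine ⟨?_, by omega⟩
    by_contra hiL
    have h0 := hi.2
    rw [hn, Nat.add_sub_cancel_left,
      Nat.mod_eq_zero_of_dvd ((pow_dvd_pow p (by omega : i ≤ L)).mul_right _)] at h0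
    have := Nat.mod_lt k (Nat.pow_pos hp.pos : 0 < p ^ i)
    omega
  have := Finset.card_le_card hss
  rw [Nat.card_Ioc] at this
  omega

lemma epow_pos (p k : ℕ) (hp : p.Prime) (hpk : p ≤ k) : 1 ≤ epow p k := by
  have := Fact.mk hp
  exact one_le_padicValNat_of_dvd (Nat.factorial_ne_zero k) ((hp.dvd_factorial).2 hpk)

lemma aexp_eq (p k : ℕ) (hp : p.Prime) (hpk : p ≤ k) :
    aexp p k = epow p k + Nat.log p k := by
  have he := epow_pos p k hp hpk
  apply le_antisymm
  · exact Nat.sInf_le (fun n n' h => mem_upper p k hp n n' h)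
  · refine le_csInf ⟨epow p k + Nat.log p k, fun n n' h => mem_upper p k hp n n' h⟩ ?_
    intro m hm
    by_contra hlt
    push Not at hlt
    set m' := max m (Nat.log p k) with hm'
    have hk0 : k ≠ 0 := by have := hp.pos; omega
    apply not_Dpred p k m' hp hk0 (le_max_right _ _) (by omega)
    have hcong : ((k % p ^ Nat.log p k : ℕ) : ℤ) ≡
        ((k % p ^ Nat.log p k + (p - 1) * p ^ m' : ℕ) : ℤ) [ZMOD (p : ℤ) ^ m] := by
      rw [Int.modEq_iff_dvd]
      push_cast
      rw [add_sub_cancel_left]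
      exact (pow_dvd_pow _ (le_max_left _ _)).mul_left _
    apply (hm _ _ hcong).1
    unfold Dpred
    rw [fallingProd_nat, Nat.descFactorial_of_lt]
    · simp
    · exact (Nat.mod_lt k (Nat.pow_pos hp.pos)).trans_le (Nat.pow_log_le_self p hk0)

theorem stmt1 (p k : ℕ) (hp : p.Prime) (hk : 2 ≤ k) (hpk : p ≤ k) :
    (-2 : ℝ) < (aexp p k : ℝ) - (k : ℝ) / ((p : ℝ) - 1) ∧
      (aexp p k : ℝ) - (k : ℝ) / ((p : ℝ) - 1) ≤ Real.logb p k := by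
  have := Fact.mk hp
  rw [aexp_eq p k hp hpk]
  have hleg : (p - 1) * epow p k = k - (p.digits k).sum := sub_one_mul_padicValNat_factorial k
  have hsum : (p.digits k).sum ≤ (Nat.log p k + 1) * (p - 1) := by
    rw [← Nat.length_digits p k hp.one_lt (by omega)]
    have := List.sum_le_card_nsmul (p.digits k) (p - 1)
      (fun x hx => Nat.le_sub_one_of_lt (Nat.digits_lt_base hp.one_lt hx))
    simpa using this
  have hp1 : (0 : ℝ) < (p : ℝ) - 1 := by
    have : (1 : ℝ) < p := by exact_mod_cast hp.one_lt
    linarith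
  have hcast : ((p - 1 : ℕ) : ℝ) = (p : ℝ) - 1 := by
    rw [Nat.cast_sub hp.one_le]; simp
  have h1 : ((p : ℝ) - 1) * epow p k ≤ k := by
    rw [← hcast]
    exact_mod_cast (by omega : (p - 1) * epow p k ≤ k)
  have h2 : (k : ℝ) ≤ ((p : ℝ) - 1) * epow p k + (Nat.log p k + 1) * ((p : ℝ) - 1) := by
    rw [← hcast]
    exact_mod_cast (by omega : k ≤ (p - 1) * epow p k + (Nat.log p k + 1) * (p - 1))
  have hlog : (Nat.log p k : ℝ) ≤ Real.logb p k := Real.natLog_le_logb k p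
  push_cast
  constructor
  · have : (k : ℝ) / ((p : ℝ) - 1) ≤ epow p k + (Nat.log p k + 1) := by
      rw [div_le_iff₀ hp1]; linarith
    linarith
  · have : (epow p k : ℝ) ≤ (k : ℝ) / ((p : ℝ) - 1) := by
      rw [le_div_iff₀ hp1]; linarith
    linarith
end

section
/- Let k ≥ 1 and set T(k) = ∏_{p prime, p ≤ k} p^{a_p(k)}. For all positive integers n, n' with n ≡ n' (mod T(k)), the condition ALLDIV_k(n) holds if and only if ALLDIV_k(n') holds; that is, ALLDIV_k(n) depends only on the congruence class of n modulo T(k). -/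
/-- `Tmod k = ∏_{p prime, p ≤ k} p^(a_p(k))`, the minimum modulus. -/
noncomputable def Tmod (k : ℕ) : ℕ :=
  ∏ p ∈ (Finset.range (k + 1)).filter Nat.Prime, p ^ aexp p k

/-- `ALLDIV k n`: for every `1 ≤ j ≤ k`, `j!` divides `C(n, j)`. -/
def AllDiv (k n : ℕ) : Prop := ∀ j : ℕ, 1 ≤ j → j ≤ k → Nat.factorial j ∣ n.choose j


lemma aux_emult (p : ℕ) (M : ℕ) (a b : ℤ) (h : a ≡ b [ZMOD (p:ℤ)^M]) (hb : ¬ (p:ℤ)^M ∣ b) :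
    emultiplicity (p:ℤ) a = emultiplicity (p:ℤ) b := by
  have h' : (p:ℤ)^M ∣ b - a := h.dvd
  have key : ∀ s : ℕ, (p:ℤ)^s ∣ a ↔ (p:ℤ)^s ∣ b := by
    intro s
    rcases le_total s M with hs | hs
    · have h2 : (p:ℤ)^s ∣ b - a := (pow_dvd_pow _ hs).trans h'
      constructor
      · intro ha
        have := dvd_add h2 ha
        simpa using this
      · intro hb
        have := dvd_sub hb h2
        simpa using this
    · constructor
      · intro ha
        exfalso
        apply hb
        have := dvd_add h' ((pow_dvd_pow (p:ℤ) hs).trans ha)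
        simpa using this
      · intro hb'
        exact absurd ((pow_dvd_pow (p:ℤ) hs).trans hb') hb
  apply le_antisymm
  · rw [emultiplicity_le_emultiplicity_iff]
    exact fun s => (key s).1
  · rw [emultiplicity_le_emultiplicity_iff]
    exact fun s => (key s).2

lemma aux_prod_low (i : ℕ) : ∏ l ∈ Finset.range i, ((i:ℤ) - l) = (i.factorial : ℤ) := by
  rw [← Finset.prod_range_reflect, ← Finset.prod_range_add_one_eq_factorial]
  push_cast
  apply Finset.prod_congr rfl
  intro l hl
  have := Finset.mem_range.1 hl
  have h2 : ((i - 1 - l : ℕ) : ℤ) = i - 1 - l := by omega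
  rw [h2]; ring

lemma aux_falling (p : ℕ) (hp : p.Prime) (k i M : ℕ) (hi : i < k) (n : ℤ)
    (hM : ∀ l < k, l ≠ i → ¬ (p:ℤ)^M ∣ (i:ℤ) - l) (hn : (p:ℤ)^M ∣ n - i) :
    emultiplicity (p:ℤ) (fallingProd k n) = emultiplicity (p:ℤ) (n - i) +
      ((epow p i + epow p (k-1-i) : ℕ) : ℕ∞) := by
  have hpz : Prime (p:ℤ) := Nat.prime_iff_prime_int.1 hp
  have hfac : ∀ m : ℕ, emultiplicity (p:ℤ) (m.factorial : ℤ) = (epow p m : ℕ∞) := by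
    intro m
    have := Fact.mk hp
    rw [Int.natCast_emultiplicity, epow, padicValNat_eq_emultiplicity (Nat.factorial_ne_zero m)]
  obtain ⟨r, rfl⟩ : ∃ r, k = i + (r + 1) := ⟨k - 1 - i, by omega⟩
  have hr : i + (r+1) - 1 - i = r := by omega
  have hcong : ∀ l < i + (r+1), l ≠ i →
      emultiplicity (p:ℤ) (n - l) = emultiplicity (p:ℤ) ((i:ℤ) - l) := by
    intro l hl hli
    apply aux_emult p M _ _ _ (hM l hl hli)
    apply Int.ModEq.sub_right
    exact (Int.modEq_iff_dvd.2 hn).symm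
  have h1 : emultiplicity (p:ℤ) (∏ l ∈ Finset.range i, (n - l)) = (epow p i : ℕ∞) := by
    rw [← hfac, ← aux_prod_low, Finset.emultiplicity_prod hpz, Finset.emultiplicity_prod hpz]
    apply Finset.sum_congr rfl
    intro l hl
    have := Finset.mem_range.1 hl
    exact hcong l (by omega) (by omega)
  have h2 : emultiplicity (p:ℤ) (∏ l ∈ Finset.range r, (n - ((i + (l+1) : ℕ) : ℤ))) = (epow p r : ℕ∞) := by
    rw [← hfac, ← Finset.prod_range_add_one_eq_factorial]
    push_cast
    rw [Finset.emultiplicity_prod hpz, Finset.emultiplicity_prod hpz]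
    apply Finset.sum_congr rfl
    intro l hl
    have := Finset.mem_range.1 hl
    have h3 := hcong (i + (l+1)) (by omega) (by omega)
    push_cast at h3
    rw [h3, ← emultiplicity_neg]
    congr 1
    ring
  rw [hr, fallingProd, Finset.prod_range_add, Finset.prod_range_succ', emultiplicity_mul hpz,
    emultiplicity_mul hpz, h1, h2]
  push_cast
  simp only [add_zero]
  ring

lemma aux_not_dvd (p M k i l : ℕ) (hk : k ≤ p^M) (hi : i < k) (hl : l < k) (hne : l ≠ i) :
    ¬ (p:ℤ)^M ∣ (i:ℤ) - l := by
  intro h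
  have := Int.eq_zero_of_abs_lt_dvd h (by
    have : (k:ℤ) ≤ (p:ℤ)^M := by exact_mod_cast hk
    rw [abs_lt]; constructor <;> omega)
  omega

lemma aux_epow_le (p : ℕ) (hp : p.Prime) (j i : ℕ) (hi : i < j) :
    epow p j ≤ Nat.log p j + (epow p i + epow p (j-1-i)) := by
  have := Fact.mk hp
  have hj : Nat.log p j < Nat.log p j + 1 := by omega
  have h1 : Nat.log p i < Nat.log p j + 1 := by
    have := Nat.log_mono_right (b := p) hi.le; omega
  have h2 : Nat.log p (j-1-i) < Nat.log p j + 1 := by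
    have := Nat.log_mono_right (b := p) (show j-1-i ≤ j by omega); omega
  rw [epow, epow, epow, padicValNat_factorial hj, padicValNat_factorial h1, padicValNat_factorial h2,
    ← Finset.sum_add_distrib]
  have h3 : Nat.log p j = ∑ t ∈ Finset.Ico 1 (Nat.log p j + 1), 1 := by simp
  conv_rhs => enter [1]; rw [h3]
  rw [← Finset.sum_add_distrib]
  apply Finset.sum_le_sum
  intro t _
  have hP : 0 < p^t := pow_pos hp.pos t
  generalize p^t = P at hP
  have e1 := Nat.div_add_mod i P
  have e2 := Nat.div_add_mod (j-1-i) P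
  have l1 := Nat.mod_lt i hP
  have l2 := Nat.mod_lt (j-1-i) hP
  rw [← Nat.lt_succ_iff, Nat.div_lt_iff_lt_mul hP]
  have : (1 + (i/P + (j-1-i)/P)).succ * P = P * (i/P) + P * ((j-1-i)/P) + 2 * P := by
    rw [Nat.succ_eq_add_one]; ring
  rw [this]; omega

lemma aux_D_of_dvd (p : ℕ) (hp : p.Prime) (j i : ℕ) (hi : i < j) (n : ℤ)
    (h : (p:ℤ)^(Nat.log p j + epow p j) ∣ n - i) : Dpred p j n := by
  rcases Nat.eq_zero_or_pos (epow p j) with he | he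
  · simp [Dpred, he]
  have hlt : j ≤ p^(Nat.log p j + epow p j) :=
    (Nat.lt_pow_succ_log_self hp.one_lt j).le.trans (Nat.pow_le_pow_right hp.pos (by omega))
  rw [Dpred, pow_dvd_iff_le_emultiplicity,
    aux_falling p hp j i _ hi n (fun l hl hne => aux_not_dvd p _ j i l hlt hi hl hne) h]
  rw [pow_dvd_iff_le_emultiplicity] at h
  refine le_trans ?_ (add_le_add_left h _)
  have := aux_epow_le p hp j i hi
  norm_cast
  omega

lemma aux_upper (p : ℕ) (hp : p.Prime) (j : ℕ) (n n' : ℤ)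
    (h : n ≡ n' [ZMOD (p:ℤ)^(Nat.log p j + epow p j)]) : Dpred p j n ↔ Dpred p j n' := by
  have hpz : Prime (p:ℤ) := Nat.prime_iff_prime_int.1 hp
  by_cases hex : ∃ i < j, (p:ℤ)^(Nat.log p j + epow p j) ∣ n - i
  · obtain ⟨i, hi, hd⟩ := hex
    have hd' : (p:ℤ)^(Nat.log p j + epow p j) ∣ n' - i := by
      have := dvd_add h.dvd hd
      simpa using this
    exact iff_of_true (aux_D_of_dvd p hp j i hi n hd) (aux_D_of_dvd p hp j i hi n' hd')
  · push Not at hex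
    have : emultiplicity (p:ℤ) (fallingProd j n') = emultiplicity (p:ℤ) (fallingProd j n) := by
      rw [fallingProd, fallingProd, Finset.emultiplicity_prod hpz, Finset.emultiplicity_prod hpz]
      apply Finset.sum_congr rfl
      intro l hl
      exact aux_emult p _ _ _ (h.symm.sub_right _) (hex l (Finset.mem_range.1 hl))
    rw [Dpred, Dpred, pow_dvd_iff_le_emultiplicity, pow_dvd_iff_le_emultiplicity, this]

lemma aux_epow_mono (p : ℕ) (hp : p.Prime) {j k : ℕ} (h : j ≤ k) : epow p j ≤ epow p k := by
  have := Fact.mk hp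
  rw [epow, epow, ← padicValNat_dvd_iff_le (Nat.factorial_ne_zero k)]
  exact pow_padicValNat_dvd.trans (Nat.factorial_dvd_factorial h)

lemma aux_lower (p : ℕ) (hp : p.Prime) (k : ℕ) (hpk : p ≤ k) (m : ℕ)
    (hm : ∀ n n' : ℤ, n ≡ n' [ZMOD ((p : ℤ) ^ m)] → (Dpred p k n ↔ Dpred p k n')) :
    Nat.log p k + epow p k ≤ m := by
  have := Fact.mk hp
  by_contra hlt
  push Not at hlt
  have hpz : Prime (p:ℤ) := Nat.prime_iff_prime_int.1 hp
  have he : 1 ≤ epow p k := by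
    rw [epow, ← padicValNat_dvd_iff_le (Nat.factorial_ne_zero k), pow_one]
    exact (Nat.Prime.dvd_factorial hp).2 hpk
  set L := Nat.log p k with hL
  set e := epow p k with hee
  have hPk : p^L ≤ k := Nat.pow_log_le_self p (by have := hp.pos; omega)
  have hkP : k < p^(L+1) := Nat.lt_pow_succ_log_self hp.one_lt k
  have hP : 0 < p^L := pow_pos hp.pos _
  obtain ⟨i, hi⟩ : ∃ i, p^L = i + 1 := ⟨p^L - 1, by omega⟩
  have hik : i < k := by omega
  have D1 : Dpred p k ((i:ℤ) + (p:ℤ)^(L+e)) :=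
    aux_D_of_dvd p hp k i hik _ (by simp [← hL, ← hee])
  have D2 : Dpred p k ((i:ℤ) + (p:ℤ)^(L+e-1)) := by
    refine (hm _ _ ?_).1 D1
    apply Int.ModEq.add_left
    have a1 : (p:ℤ)^m ∣ (p:ℤ)^(L+e) := pow_dvd_pow _ (by omega)
    have a2 : (p:ℤ)^m ∣ (p:ℤ)^(L+e-1) := pow_dvd_pow _ (by omega)
    exact Int.modEq_iff_dvd.2 (dvd_sub a2 a1)
  have hnd : ∀ l < k, l ≠ i → ¬ (p:ℤ)^(L+e-1) ∣ (i:ℤ) - l := by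
    intro l hl hne
    rcases Nat.lt_or_ge e 2 with h2 | h2
    · have he1 : e = 1 := by omega
      have hk2 : k < 2 * p^L := by
        by_contra hk2
        push Not at hk2
        have hL1 : 1 ≤ L := by
          have := Nat.log_pos hp.one_lt hpk; omega
        have hpL : p ≤ p^L := Nat.le_self_pow (by omega) p
        have h3 : p * 2 ≤ k := by omega
        have h4 : p^2 ∣ (p*2).factorial := by
          have h5 := Nat.factorial_mul_factorial_dvd_factorial_add p p
          have h6 := Nat.dvd_factorial hp.pos le_rfl
          rw [pow_two, mul_two]
          exact (mul_dvd_mul h6 h6).trans h5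
        have h5 : 2 ≤ e := by
          rw [hee, epow, ← padicValNat_dvd_iff_le (Nat.factorial_ne_zero k)]
          exact h4.trans (Nat.factorial_dvd_factorial h3)
        omega
      intro hd
      have := Int.eq_zero_of_abs_lt_dvd hd (by
        have e1 : L + e - 1 = L := by omega
        rw [e1]
        have : (p:ℤ)^L = i + 1 := by exact_mod_cast hi
        rw [this, abs_lt]; constructor <;> omega)
      omega
    · exact aux_not_dvd p _ k i l
        (hkP.le.trans (Nat.pow_le_pow_right hp.pos (by omega))) hik hl hne
  rw [Dpred, pow_dvd_iff_le_emultiplicity,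
    aux_falling p hp k i _ hik _ hnd (by simp), add_sub_cancel_left,
    emultiplicity_pow_self hpz.ne_zero hpz.not_isUnit] at D2
  norm_cast at D2
  have hup : L + (epow p i + epow p (k-1-i)) ≤ e := by
    have hc : p^L * i.factorial * (k-1-i).factorial ∣ k.factorial := by
      have := Nat.factorial_mul_factorial_dvd_factorial (show i+1 ≤ k by omega)
      rw [Nat.factorial_succ, ← hi] at this
      rwa [hi, show k - (i+1) = k-1-i by omega, ← hi] at this
    rw [hee, epow, epow, epow, ← padicValNat_dvd_iff_le (Nat.factorial_ne_zero k), pow_add, pow_add]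
    refine dvd_trans ?_ hc
    rw [mul_assoc]
    exact mul_dvd_mul_left _ (mul_dvd_mul pow_padicValNat_dvd pow_padicValNat_dvd)
  omega

lemma aux_cast (n j : ℕ) : fallingProd j (n:ℤ) = (n.descFactorial j : ℤ) := by
  induction j with
  | zero => simp [fallingProd]
  | succ j ih =>
    rw [fallingProd, Finset.prod_range_succ, ← fallingProd, ih, Nat.descFactorial_succ]
    rcases le_or_gt j n with h | h
    · push_cast [Nat.cast_sub h]; ring
    · simp [Nat.descFactorial_of_lt h]

lemma aux_allDiv (k n : ℕ) :
    AllDiv k n ↔ ∀ j, 1 ≤ j → j ≤ k → ∀ p : ℕ, p.Prime → Dpred p j n := by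
  have hD : ∀ p j, Dpred p j n ↔ p^(2 * epow p j) ∣ n.descFactorial j := by
    intro p j
    rw [Dpred, aux_cast]
    norm_cast
  unfold AllDiv
  refine forall_congr' fun j => forall_congr' fun _ => forall_congr' fun _ => ?_
  rw [← Nat.mul_dvd_mul_iff_left (Nat.factorial_pos j), ← Nat.descFactorial_eq_factorial_mul_choose]
  constructor
  · intro h p hp
    rw [hD]
    refine dvd_trans ?_ h
    rw [two_mul, pow_add]
    exact mul_dvd_mul pow_padicValNat_dvd pow_padicValNat_dvd
  · intro h
    rw [Nat.dvd_iff_prime_pow_dvd_dvd]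
    intro p s hp hs
    have := Fact.mk hp
    have h1 := (hD p j).1 (h p hp)
    refine dvd_trans (pow_dvd_pow p ?_) h1
    have hne := Nat.factorial_ne_zero j
    rw [padicValNat_dvd_iff_le (mul_ne_zero hne hne), padicValNat.mul hne hne] at hs
    rw [epow]; omega

theorem stmt9 (k : ℕ) (hk : 1 ≤ k) (n n' : ℕ) (hn : 0 < n) (hn' : 0 < n')
    (h : n ≡ n' [MOD Tmod k]) : AllDiv k n ↔ AllDiv k n' := by
  rw [aux_allDiv, aux_allDiv]
  refine forall_congr' fun j => forall_congr' fun _ => forall_congr' fun hjk =>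
    forall_congr' fun p => forall_congr' fun hp => ?_
  rcases lt_or_ge j p with hjp | hpj
  · have : epow p j = 0 := by
      rw [epow]
      apply padicValNat.eq_zero_of_not_dvd
      rw [hp.dvd_factorial]; omega
    simp [Dpred, this]
  · have hpk : p ≤ k := hpj.trans hjk
    apply aux_upper p hp j
    have hle : Nat.log p j + epow p j ≤ aexp p k := by
      have h1 : Nat.log p k + epow p k ≤ aexp p k :=
        aux_lower p hp k hpk _ (Nat.sInf_mem (s := {m : ℕ | ∀ n n' : ℤ, n ≡ n' [ZMOD ((p : ℤ) ^ m)] →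
          (Dpred p k n ↔ Dpred p k n')}) ⟨_, fun a b hab => aux_upper p hp k a b hab⟩)
      have := aux_epow_mono p hp hjk
      have := Nat.log_mono_right (b := p) hjk
      omega
    have hT : p^(Nat.log p j + epow p j) ∣ Tmod k :=
      (pow_dvd_pow p hle).trans (Finset.dvd_prod_of_mem (fun p => p ^ aexp p k)
        (by simp [hp]; omega))
    have := Int.natCast_modEq_iff.2 (h.of_dvd hT)
    push_cast at this
    exact this
end
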